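/- arXiv:1211.5483 — 2 statements merged into one kernel-verified Lean document; each statement's English description precedes it below -/
import Mathlib

section
/- Let μ be a probability measure on the Euclidean space ℝ^d with zero mean (∫ x dμ(x) = 0) and finite second moments (∫ ‖x‖² dμ(x) < ∞). Let G : ℝ^d → ℂ be the Gaussian function G(r) = exp(−(1/2)·∫ ⟨r,x⟩² dμ(x)). Then for every radius r₀ > 0 and every accuracy ε > 0 there exists N_ε such that for all natural numbers N ≥ N_ε and all r ∈ ℝ^d with ‖r‖ ≤ r₀ one has |(charFun μ (r/√N))^N − G(r)| < ε; i.e., the sequence r ↦ (charFun μ (r/√N))^N converges to G uniformly on every closed ball. -/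
open MeasureTheory Filter

/-- The characteristic function of a measure `μ` on a real inner product space:
`charFun μ r = ∫ exp(i⟪r, x⟫) dμ(x)`. -/
noncomputable def charFun {E : Type*} [MeasurableSpace E] [NormedAddCommGroup E]
    [InnerProductSpace ℝ E] (μ : Measure E) (r : E) : ℂ :=
  ∫ x, Complex.exp (Complex.I * ((inner ℝ r x : ℝ) : ℂ)) ∂μ

theorem aux_R (t : ℝ) :
    ‖Complex.exp (Complex.I * (t : ℂ)) - 1 - Complex.I * t + (t : ℂ) ^ 2 / 2‖
      ≤ 4 * t ^ 2 * min 1 |t| := by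
  have hn : ‖Complex.I * (t : ℂ)‖ = |t| := by simp
  rcases le_or_gt |t| 1 with h | h
  · rw [min_eq_right h]
    have := Complex.exp_bound (x := Complex.I * (t : ℂ)) (by rw [hn]; exact h) (n := 3) (by norm_num)
    rw [hn] at this
    have e : Complex.exp (Complex.I * (t : ℂ)) - 1 - Complex.I * t + (t : ℂ) ^ 2 / 2
        = Complex.exp (Complex.I * (t : ℂ)) -
          ∑ m ∈ Finset.range 3, (Complex.I * (t : ℂ)) ^ m / (m.factorial : ℂ) := by
      simp [Finset.sum_range_succ, Nat.factorial, mul_pow]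
      ring
    rw [e]
    refine this.trans ?_
    have e4 : 4 * t ^ 2 * |t| = 4 * |t| ^ 3 := by rw [← sq_abs t]; ring
    rw [e4]
    norm_num [Nat.factorial]
    nlinarith [pow_nonneg (abs_nonneg t) 3]
  · rw [min_eq_left h.le]
    have h1 : ‖Complex.exp (Complex.I * (t : ℂ))‖ = 1 := by
      rw [mul_comm]; exact Complex.norm_exp_ofReal_mul_I t
    have h2 : ‖(t : ℂ) ^ 2 / 2‖ = |t| ^ 2 / 2 := by simp
    have a := norm_add_le (Complex.exp (Complex.I * (t : ℂ)) - 1 - Complex.I * t) ((t : ℂ) ^ 2 / 2)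
    have b := norm_sub_le (Complex.exp (Complex.I * (t : ℂ)) - 1) (Complex.I * t)
    have c := norm_sub_le (Complex.exp (Complex.I * (t : ℂ))) 1
    rw [h1, norm_one] at c
    rw [hn] at b
    rw [h2] at a
    rw [← sq_abs t]
    nlinarith

theorem aux_pow (a b : ℂ) (ha : ‖a‖ ≤ 1) (hb : ‖b‖ ≤ 1) (n : ℕ) :
    ‖a ^ n - b ^ n‖ ≤ n * ‖a - b‖ := by
  induction n with
  | zero => simp
  | succ n ih =>
    have e : a ^ (n + 1) - b ^ (n + 1) = a ^ n * (a - b) + (a ^ n - b ^ n) * b := by ring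
    rw [e]
    refine (norm_add_le _ _).trans ?_
    rw [norm_mul, norm_mul, norm_pow]
    have h1 : ‖a‖ ^ n ≤ 1 := pow_le_one₀ (norm_nonneg _) ha
    have h2 := mul_le_mul_of_nonneg_right h1 (norm_nonneg (a - b))
    have h3 := mul_le_mul_of_nonneg_left hb (norm_nonneg (a ^ n - b ^ n))
    push_cast
    linarith

theorem aux_expand {d : ℕ}
    (μ : Measure (EuclideanSpace ℝ (Fin d))) [IsProbabilityMeasure μ]
    (hint1 : Integrable (fun x : EuclideanSpace ℝ (Fin d) => x) μ)
    (hint2 : Integrable (fun x : EuclideanSpace ℝ (Fin d) => ‖x‖ ^ 2) μ)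
    (hmean : ∫ x, x ∂μ = 0) (u : EuclideanSpace ℝ (Fin d)) (c : ℝ) (hu : ‖u‖ ≤ c) :
    ‖_root_.charFun μ u - 1 + ((∫ x, ((inner ℝ u x : ℝ)) ^ 2 ∂μ : ℝ) : ℂ) / 2‖ ≤
      ∫ x, 4 * (c * ‖x‖) ^ 2 * min 1 (c * ‖x‖) ∂μ := by
  have hc : 0 ≤ c := (norm_nonneg u).trans hu
  have hin (x : EuclideanSpace ℝ (Fin d)) : |(inner ℝ u x : ℝ)| ≤ c * ‖x‖ :=
    (abs_real_inner_le_norm u x).trans (by gcongr)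
  have i0 : Integrable (fun x => Complex.exp (Complex.I * ((inner ℝ u x : ℝ) : ℂ))) μ := by
    refine Integrable.of_bound (C := 1) (by fun_prop) (Eventually.of_forall fun x => ?_)
    rw [mul_comm, Complex.norm_exp_ofReal_mul_I]
  have i1 : Integrable (fun x => (inner ℝ u x : ℝ)) μ := hint1.const_inner u
  have i2 : Integrable (fun x => (inner ℝ u x : ℝ) ^ 2) μ := by
    refine (hint2.const_mul (c ^ 2)).mono' (by fun_prop) (Eventually.of_forall fun x => ?_)
    rw [Real.norm_eq_abs, abs_pow, ← mul_pow]
    exact pow_le_pow_left₀ (abs_nonneg _) (hin x) 2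
  have i1' : Integrable (fun x => Complex.I * ((inner ℝ u x : ℝ) : ℂ)) μ := i1.ofReal.const_mul _
  have i2' : Integrable (fun x => ((inner ℝ u x : ℝ) : ℂ) ^ 2 / 2) μ := by
    have := i2.ofReal (𝕜 := ℂ)
    push_cast at this
    exact this.div_const 2
  have e1 : ∫ x, (inner ℝ u x : ℝ) ∂μ = 0 := by
    rw [integral_inner hint1, hmean, inner_zero_right]
  have e2 : ∫ x, Complex.I * ((inner ℝ u x : ℝ) : ℂ) ∂μ = 0 := by
    rw [integral_const_mul, integral_complex_ofReal, e1]; simp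
  have e3 : ∫ x, ((inner ℝ u x : ℝ) : ℂ) ^ 2 / 2 ∂μ
      = ((∫ x, ((inner ℝ u x : ℝ)) ^ 2 ∂μ : ℝ) : ℂ) / 2 := by
    rw [integral_div, ← integral_complex_ofReal]; simp
  have key : _root_.charFun μ u - 1 + ((∫ x, ((inner ℝ u x : ℝ)) ^ 2 ∂μ : ℝ) : ℂ) / 2
      = ∫ x, (Complex.exp (Complex.I * ((inner ℝ u x : ℝ) : ℂ)) - 1
        - Complex.I * ((inner ℝ u x : ℝ) : ℂ) + ((inner ℝ u x : ℝ) : ℂ) ^ 2 / 2) ∂μ := by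
    have i3 : Integrable (fun x => Complex.exp (Complex.I * ((inner ℝ u x : ℝ) : ℂ)) - 1) μ :=
      i0.sub (integrable_const 1)
    have i4 : Integrable (fun x => Complex.exp (Complex.I * ((inner ℝ u x : ℝ) : ℂ)) - 1
        - Complex.I * ((inner ℝ u x : ℝ) : ℂ)) μ := i3.sub i1'
    rw [integral_add i4 i2', integral_sub i3 i1', integral_sub i0 (integrable_const 1), e2, e3]
    simp [_root_.charFun]
  rw [key]
  refine norm_integral_le_of_norm_le ?_ (Eventually.of_forall fun x => ?_)
  · refine (hint2.const_mul (4 * c ^ 2)).mono' (by fun_prop) (Eventually.of_forall fun x => ?_)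
    have : 0 ≤ min 1 (c * ‖x‖) := le_min zero_le_one (by positivity)
    rw [Real.norm_of_nonneg (by positivity)]
    have h : min 1 (c * ‖x‖) ≤ 1 := min_le_left _ _
    calc 4 * (c * ‖x‖) ^ 2 * min 1 (c * ‖x‖) ≤ 4 * (c * ‖x‖) ^ 2 * 1 := by gcongr
      _ = _ := by ring
  · refine (aux_R _).trans ?_
    rw [← sq_abs (inner ℝ u x : ℝ)]
    have h := hin x
    gcongr

theorem aux_lim {d : ℕ}
    (μ : Measure (EuclideanSpace ℝ (Fin d))) [IsProbabilityMeasure μ]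
    (hint2 : Integrable (fun x : EuclideanSpace ℝ (Fin d) => ‖x‖ ^ 2) μ)
    (c : ℝ) (hc : 0 < c) :
    Tendsto (fun N : ℕ => ∫ x, 4 * (c * ‖x‖) ^ 2 * min 1 ((Real.sqrt N)⁻¹ * c * ‖x‖) ∂μ)
      atTop (nhds 0) := by
  have h0 : Tendsto (fun N : ℕ => (Real.sqrt N)⁻¹) atTop (nhds 0) :=
    tendsto_inv_atTop_zero.comp (Real.tendsto_sqrt_atTop.comp tendsto_natCast_atTop_atTop)
  rw [show (0 : ℝ) = ∫ x : EuclideanSpace ℝ (Fin d), (0 : ℝ) ∂μ by simp]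
  refine tendsto_integral_of_dominated_convergence (fun x => 4 * c ^ 2 * ‖x‖ ^ 2)
    (fun N => by fun_prop) (hint2.const_mul _) (fun N => Eventually.of_forall fun x => ?_)
    (Eventually.of_forall fun x => ?_)
  · have : 0 ≤ min 1 ((Real.sqrt N)⁻¹ * c * ‖x‖) := le_min zero_le_one (by positivity)
    rw [Real.norm_of_nonneg (by positivity)]
    have h : min 1 ((Real.sqrt N)⁻¹ * c * ‖x‖) ≤ 1 := min_le_left _ _
    calc 4 * (c * ‖x‖) ^ 2 * min 1 ((Real.sqrt N)⁻¹ * c * ‖x‖)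
        ≤ 4 * (c * ‖x‖) ^ 2 * 1 := by gcongr
      _ = _ := by ring
  · have h1 : Tendsto (fun N : ℕ => (Real.sqrt N)⁻¹ * c * ‖x‖) atTop (nhds 0) := by
      simpa using (h0.mul_const c).mul_const ‖x‖
    have h2 := ((tendsto_const_nhds (x := (1 : ℝ))).min h1).const_mul (4 * (c * ‖x‖) ^ 2)
    simpa using h2

/-- General (commutative) central limit theorem, Theorem 1: for a probability
measure `μ` on `ℝ^d` with zero mean and finite second moments, the sequence
`r ↦ (charFun μ (r/√N))^N` converges, uniformly on every closed ball, to the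
Gaussian `G(r) = exp(−(1/2)·∫ ⟪r,x⟫² dμ)` with the same second moments. -/
theorem central_limit_uniform_on_balls {d : ℕ}
    (μ : Measure (EuclideanSpace ℝ (Fin d))) [IsProbabilityMeasure μ]
    (hint1 : Integrable (fun x : EuclideanSpace ℝ (Fin d) => x) μ)
    (hint2 : Integrable (fun x : EuclideanSpace ℝ (Fin d) => ‖x‖ ^ 2) μ)
    (hmean : ∫ x, x ∂μ = 0)
    (G : EuclideanSpace ℝ (Fin d) → ℂ)
    (hG : ∀ r, G r = Complex.exp (-(1 / 2 : ℂ) *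
      ((∫ x, ((inner ℝ r x : ℝ)) ^ 2 ∂μ : ℝ) : ℂ))) :
    ∀ r₀ > (0 : ℝ), ∀ ε > (0 : ℝ), ∃ Nε : ℕ, ∀ N ≥ Nε,
      ∀ r : EuclideanSpace ℝ (Fin d), ‖r‖ ≤ r₀ →
        ‖(_root_.charFun μ ((Real.sqrt N)⁻¹ • r)) ^ N - G r‖ < ε := by
  intro r₀ hr₀ ε hε
  set M := ∫ x, ‖x‖ ^ 2 ∂μ with hM
  have hM0 : 0 ≤ M := integral_nonneg fun x => by positivity
  set K := r₀ ^ 2 * M / 2 with hK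
  have hK0 : 0 ≤ K := by positivity
  have l1 := aux_lim μ hint2 r₀ hr₀
  have l2 : Tendsto (fun N : ℕ => K / (N : ℝ)) atTop (nhds 0) :=
    tendsto_const_div_atTop_nhds_zero_nat K
  have l3 : Tendsto (fun N : ℕ => K ^ 2 / (N : ℝ)) atTop (nhds 0) :=
    tendsto_const_div_atTop_nhds_zero_nat (K ^ 2)
  have ev := ((l1.eventually_lt_const (half_pos hε)).and
    (l2.eventually_lt_const one_pos)).and
    ((l3.eventually_lt_const (half_pos hε)).and (eventually_gt_atTop 0))
  obtain ⟨Nε, hN⟩ := eventually_atTop.1 ev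
  refine ⟨Nε, fun N hNN r hr => ?_⟩
  obtain ⟨⟨h1, h2⟩, h3, hpos⟩ := hN N hNN
  have hNpos : (0 : ℝ) < N := by exact_mod_cast hpos
  set s := ∫ x, ((inner ℝ r x : ℝ)) ^ 2 ∂μ with hs
  have hs0 : 0 ≤ s := integral_nonneg fun x => by positivity
  have hsM : s / 2 ≤ K := by
    have : s ≤ r₀ ^ 2 * M := by
      rw [hs, hM, ← integral_const_mul]
      refine integral_mono_of_nonneg (Eventually.of_forall fun x => by positivity)
        (hint2.const_mul _) (Eventually.of_forall fun x => ?_)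
      show (inner ℝ r x : ℝ) ^ 2 ≤ r₀ ^ 2 * ‖x‖ ^ 2
      rw [← sq_abs, ← mul_pow]
      refine pow_le_pow_left₀ (abs_nonneg _) ((abs_real_inner_le_norm r x).trans ?_) 2
      gcongr
    rw [hK]; linarith
  set y := s / 2 / N with hy
  have hy0 : 0 ≤ y := by positivity
  have hyK : y ≤ K / N := by rw [hy]; gcongr
  have hGN : G r = (((Real.exp (-y) : ℝ)) : ℂ) ^ N := by
    rw [hG, ← hs, Complex.ofReal_exp, ← Complex.exp_nat_mul]
    congr 1
    rw [hy]
    push_cast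
    have : (N : ℂ) ≠ 0 := by exact_mod_cast hpos.ne'
    field_simp
  have hg1 : ‖((Real.exp (-y) : ℝ) : ℂ)‖ ≤ 1 := by
    rw [Complex.norm_real, Real.norm_of_nonneg (Real.exp_pos _).le, Real.exp_le_one_iff]
    linarith
  set u := (Real.sqrt N)⁻¹ • r with hu
  have hφ1 : ‖_root_.charFun μ u‖ ≤ 1 := by
    unfold _root_.charFun
    refine (norm_integral_le_of_norm_le_const (C := 1) (Eventually.of_forall fun x => ?_)).trans ?_
    · rw [mul_comm, Complex.norm_exp_ofReal_mul_I]
    · simp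
  have hun : ‖u‖ ≤ (Real.sqrt N)⁻¹ * r₀ := by
    rw [hu, norm_smul, Real.norm_of_nonneg (by positivity)]
    gcongr
  have hsq : ((Real.sqrt N)⁻¹) ^ 2 = (N : ℝ)⁻¹ := by
    rw [inv_pow, Real.sq_sqrt hNpos.le]
  have hex := aux_expand μ hint1 hint2 hmean u _ hun
  have hq : ∫ x, ((inner ℝ u x : ℝ)) ^ 2 ∂μ = s / N := by
    simp_rw [hu, real_inner_smul_left, mul_pow, hsq]
    rw [integral_const_mul]; ring
  have hq2 : ((∫ x, ((inner ℝ u x : ℝ)) ^ 2 ∂μ : ℝ) : ℂ) / 2 = (y : ℂ) := by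
    rw [hq, hy]; push_cast; ring
  have hI : ∫ x, 4 * ((Real.sqrt N)⁻¹ * r₀ * ‖x‖) ^ 2 * min 1 ((Real.sqrt N)⁻¹ * r₀ * ‖x‖) ∂μ
      = (N : ℝ)⁻¹ * ∫ x, 4 * (r₀ * ‖x‖) ^ 2 * min 1 ((Real.sqrt N)⁻¹ * r₀ * ‖x‖) ∂μ := by
    rw [← integral_const_mul, ← hsq]
    congr 1; ext x; ring
  rw [hq2, hI] at hex
  have hgb : ‖((Real.exp (-y) : ℝ) : ℂ) - 1 + y‖ ≤ y ^ 2 := by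
    have := Real.norm_exp_sub_one_sub_id_le (x := -y) (by
      rw [norm_neg, Real.norm_of_nonneg hy0]; linarith)
    rw [norm_neg, Real.norm_of_nonneg hy0, sub_neg_eq_add] at this
    rw [← Complex.norm_real] at this
    push_cast at this ⊢
    exact this
  have hd : ‖_root_.charFun μ u - ((Real.exp (-y) : ℝ) : ℂ)‖ ≤
      (N : ℝ)⁻¹ * (∫ x, 4 * (r₀ * ‖x‖) ^ 2 * min 1 ((Real.sqrt N)⁻¹ * r₀ * ‖x‖) ∂μ) + y ^ 2 := by
    have e : _root_.charFun μ u - ((Real.exp (-y) : ℝ) : ℂ)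
        = (_root_.charFun μ u - 1 + y) - (((Real.exp (-y) : ℝ) : ℂ) - 1 + y) := by ring
    rw [e]
    exact (norm_sub_le _ _).trans (add_le_add hex hgb)
  rw [hGN]
  refine (aux_pow _ _ hφ1 hg1 N).trans_lt ?_
  refine (mul_le_mul_of_nonneg_left hd hNpos.le).trans_lt ?_
  rw [mul_add, mul_inv_cancel_left₀ hNpos.ne']
  have hy2 : (N : ℝ) * y ^ 2 ≤ K ^ 2 / N := by
    calc (N : ℝ) * y ^ 2 ≤ N * (K / N) ^ 2 := by gcongr
      _ = K ^ 2 / N := by field_simp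
  linarith
end

section
/- Let μ be a probability measure on ℝ with zero mean (∫ x dμ(x) = 0), all moments finite (∫ |x|^k dμ(x) < ∞ for every k), and variance ν = ∫ x² dμ(x). For N ≥ 1, let μ_N denote the pushforward under x ↦ x/√N of the N-fold convolution μ ∗ ⋯ ∗ μ (N factors), and let γ be the Gaussian measure on ℝ with mean 0 and variance ν. Then for every real polynomial p, ∫ p(x) dμ_N(x) converges, as N → ∞, to ∫ p(x) dγ(x). -/
open MeasureTheory ProbabilityTheory Filter

/-- The `N`-fold convolution power of a measure `μ` on `ℝ`:
`convPow μ 1 = μ` and `convPow μ (N+1) = (convPow μ N) ∗ μ`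
(with `convPow μ 0` the Dirac measure at `0`). -/
noncomputable def convPow (μ : Measure ℝ) : ℕ → Measure ℝ
  | 0 => Measure.dirac 0
  | N + 1 => (convPow μ N).conv μ

open Asymptotics in
lemma cl_step (u : ℕ → ℝ) (e : ℕ) (h0 : u 0 = 0)
    (h : (fun N => u (N+1) - u N) =O[⊤] (fun N : ℕ => ((N:ℝ)+1)^e)) :
    u =O[⊤] (fun N : ℕ => ((N:ℝ)+1)^(e+1)) := by
  rw [isBigO_top] at h ⊢
  obtain ⟨C, hC⟩ := h
  have hpos : ∀ N : ℕ, (0:ℝ) < ((N:ℝ)+1)^e := fun N => by positivity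
  have hC0 : 0 ≤ C := by
    have := (norm_nonneg _).trans (hC 0)
    simpa using this
  refine ⟨C, fun N => ?_⟩
  have key : |u N| ≤ C * (N * ((N:ℝ)+1)^e) := by
    induction N with
    | zero => simp [h0]
    | succ N ih =>
      have h1 := hC N
      rw [Real.norm_eq_abs, Real.norm_eq_abs, abs_of_pos (hpos N)] at h1
      have h2 : |u (N+1)| ≤ |u (N+1) - u N| + |u N| := by
        simpa using abs_add_le (u (N+1) - u N) (u N)
      have h3 : ((N:ℝ)+1)^e ≤ (((N+1:ℕ):ℝ)+1)^e := by
        gcongr; simp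
      calc |u (N+1)| ≤ C * ((N+1) * ((N:ℝ)+1)^e) := by nlinarith
        _ ≤ C * ((N+1) * (((N+1:ℕ):ℝ)+1)^e) := by gcongr
        _ = _ := by push_cast; ring
  rw [Real.norm_eq_abs, Real.norm_eq_abs, abs_of_pos (a := ((N:ℝ)+1)^(e+1)) (by positivity)]
  refine key.trans ?_
  rw [pow_succ']
  gcongr
  linarith

open Asymptotics in
lemma cl_mono (u : ℕ → ℝ) (d e : ℕ) (hde : d ≤ e)
    (h : u =O[⊤] (fun N : ℕ => ((N:ℝ)+1)^d)) :
    u =O[⊤] (fun N : ℕ => ((N:ℝ)+1)^e) := by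
  refine h.trans (isBigO_top.2 ⟨1, fun N => ?_⟩)
  rw [Real.norm_eq_abs, Real.norm_eq_abs, abs_of_pos (by positivity), abs_of_pos (by positivity),
    one_mul]
  exact pow_le_pow_right₀ (by simp) hde

/-- abstract moment recursion -/
def ClRec (a : ℕ → ℝ) (m : ℕ → ℕ → ℝ) : Prop :=
  (∀ k, m k 0 = 0 ^ k) ∧
  (∀ k N, m k (N+1) = ∑ j ∈ Finset.range (k+1), m (k-j) N * a j * (k.choose j : ℝ)) ∧
  a 0 = 1 ∧ a 1 = 0

lemma ClRec.zero {a m} (h : ClRec a m) (N : ℕ) : m 0 N = 1 := by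
  induction N with
  | zero => simp [h.1]
  | succ N ih => rw [h.2.1]; simp [ih, h.2.2.1]

lemma ClRec.one {a m} (h : ClRec a m) (N : ℕ) : m 1 N = 0 := by
  induction N with
  | zero => simp [h.1]
  | succ N ih => rw [h.2.1]; simp [Finset.sum_range_succ, ih, h.2.2.2]

lemma ClRec.diff {a m} (h : ClRec a m) (k N : ℕ) : m (k+2) (N+1) - m (k+2) N =
    ∑ j ∈ Finset.range (k+1), m (k-j) N * a (j+2) * ((k+2).choose (j+2) : ℝ) := by
  rw [h.2.1, Finset.sum_range_succ', Finset.sum_range_succ']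
  simp [h.2.2.1, h.2.2.2]

open Asymptotics in
lemma ClRec.bound {a m} (h : ClRec a m) (k : ℕ) :
    (m k) =O[⊤] (fun N : ℕ => ((N:ℝ)+1)^(k/2)) := by
  induction k using Nat.strong_induction_on with
  | _ k ih =>
  match k with
  | 0 => exact isBigO_top.2 ⟨1, fun N => by simp [h.zero]⟩
  | 1 => exact isBigO_top.2 ⟨1, fun N => by simp [h.one]⟩
  | k+2 =>
    rw [show (k+2)/2 = k/2+1 by omega]
    apply cl_step _ _ (by simp [h.1])
    simp only [h.diff]
    refine IsBigO.fun_sum fun j _ => ?_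
    simp only [mul_assoc]
    simp only [mul_comm (m _ _)]
    exact (cl_mono _ _ _ (by omega) (ih (k-j) (by omega))).const_mul_left _

open Asymptotics in
lemma ClRec.compare {a m b n} (h : ClRec a m) (h' : ClRec b n) (hab : a 2 = b 2) (k : ℕ) :
    (fun N => m k N - n k N) =O[⊤] (fun N : ℕ => ((N:ℝ)+1)^((k-1)/2)) := by
  induction k using Nat.strong_induction_on with
  | _ k ih =>
  match k with
  | 0 => exact isBigO_top.2 ⟨1, fun N => by simp [h.zero, h'.zero]⟩
  | 1 => exact isBigO_top.2 ⟨1, fun N => by simp [h.one, h'.one]⟩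
  | 2 =>
    have : ∀ N, m 2 N - n 2 N = 0 := by
      intro N
      induction N with
      | zero => simp [h.1, h'.1]
      | succ N ihN =>
        have h1 := h.diff 0 N
        have h2 := h'.diff 0 N
        simp [h.zero, h'.zero, hab] at h1 h2
        linarith
    simp only [this]
    exact isBigO_zero _ _
  | k+3 =>
    rw [show (k+3-1)/2 = k/2+1 by omega]
    apply cl_step _ _ (by simp [h.1, h'.1])
    have e : ∀ N, (m (k+3) (N+1) - n (k+3) (N+1)) - (m (k+3) N - n (k+3) N) =
      (a 2 * ((k+3).choose 2 : ℝ)) * (m (k+1) N - n (k+1) N) +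
      ((∑ j ∈ Finset.range (k+1), (a (j+3) * ((k+3).choose (j+3) : ℝ)) * m (k-j) N) -
       (∑ j ∈ Finset.range (k+1), (b (j+3) * ((k+3).choose (j+3) : ℝ)) * n (k-j) N)) := by
      intro N
      have h1 := h.diff (k+1) N
      have h2 := h'.diff (k+1) N
      rw [Finset.sum_range_succ'] at h1 h2
      simp only [Nat.add_sub_add_right, Nat.sub_zero, zero_add] at h1 h2
      have e1 : ∀ (c : ℕ → ℝ) (q : ℕ → ℕ → ℝ),
        ∑ j ∈ Finset.range (k+1), (c (j+3) * ((k+3).choose (j+3) : ℝ)) * q (k-j) N =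
        ∑ j ∈ Finset.range (k+1), q (k-j) N * c (j+1+2) * ((k+1+2).choose (j+1+2) : ℝ) :=
        fun c q => Finset.sum_congr rfl fun j _ => by ring
      rw [e1, e1]
      rw [← hab] at h2
      linear_combination h1 - h2
    simp only [e]
    refine IsBigO.add ?_ (IsBigO.sub ?_ ?_)
    · refine IsBigO.const_mul_left ?_ _
      simpa using ih (k+1) (by omega)
    · refine IsBigO.fun_sum fun j _ => ?_
      exact (cl_mono _ _ _ (by omega) (h.bound (k-j))).const_mul_left _
    · refine IsBigO.fun_sum fun j _ => ?_
      exact (cl_mono _ _ _ (by omega) (h'.bound (k-j))).const_mul_left _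

lemma ClRec.tendsto {a m b n} (h : ClRec a m) (h' : ClRec b n) (hab : a 2 = b 2) (k : ℕ) :
    Tendsto (fun N : ℕ => (m k N - n k N) / Real.sqrt N ^ k) atTop (nhds 0) := by
  rcases Nat.eq_zero_or_pos k with rfl | hk
  · simp [h.zero, h'.zero]
  obtain ⟨C, hC⟩ := Asymptotics.isBigO_top.1 (h.compare h' hab k)
  have hC0 : 0 ≤ C := by
    have := (norm_nonneg _).trans (hC 0)
    simpa using this
  have hs : Tendsto (fun N : ℕ => (C * 2^(k-1)) / Real.sqrt N) atTop (nhds 0) :=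
    (Real.tendsto_sqrt_atTop.comp tendsto_natCast_atTop_atTop).const_div_atTop _
  refine squeeze_zero_norm' ?_ hs
  filter_upwards [eventually_ge_atTop 1] with N hN
  have hN' : (1:ℝ) ≤ N := by exact_mod_cast hN
  have hsp : 0 < Real.sqrt N := Real.sqrt_pos.2 (by linarith)
  have hsq : Real.sqrt N ^ 2 = N := Real.sq_sqrt (by linarith)
  have h1 : ((N:ℝ)+1)^((k-1)/2) ≤ (2 * Real.sqrt N)^(k-1) := by
    have h2 : (1:ℝ) ≤ 2 * Real.sqrt N := by nlinarith
    calc ((N:ℝ)+1)^((k-1)/2) ≤ ((2 * Real.sqrt N)^2)^((k-1)/2) := by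
          gcongr; nlinarith
      _ = (2 * Real.sqrt N)^(2*((k-1)/2)) := by rw [pow_mul]
      _ ≤ _ := pow_le_pow_right₀ h2 (by omega)
  have h3 := hC N
  simp only [Real.norm_eq_abs] at h3
  rw [abs_of_pos (a := ((N:ℝ)+1)^_) (by positivity)] at h3
  rw [Real.norm_eq_abs, abs_div, abs_of_pos (a := Real.sqrt N ^ k) (by positivity),
    div_le_div_iff₀ (by positivity) hsp]
  have h4 : Real.sqrt N ^ k = Real.sqrt N ^ (k-1) * Real.sqrt N := by
    rw [← pow_succ]; congr 1; omega
  rw [h4]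
  have h5 : |m k N - n k N| ≤ C * (2^(k-1) * Real.sqrt N ^(k-1)) := by
    rw [← mul_pow]; exact h3.trans (by gcongr)
  nlinarith

lemma cl_conv_pow (α β : Measure ℝ) [IsProbabilityMeasure α] [IsProbabilityMeasure β]
    (hα : ∀ k : ℕ, Integrable (fun x : ℝ => x ^ k) α)
    (hβ : ∀ k : ℕ, Integrable (fun x : ℝ => x ^ k) β) (k : ℕ) :
    Integrable (fun x : ℝ => x ^ k) (α.conv β) ∧ ∫ x, x ^ k ∂(α.conv β) =
      ∑ j ∈ Finset.range (k+1), (∫ x, x ^ (k-j) ∂α) * (∫ x, x ^ j ∂β) * (k.choose j : ℝ) := by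
  have e : ∀ z : ℝ × ℝ, (z.1 + z.2)^k =
      ∑ j ∈ Finset.range (k+1), z.1 ^ (k-j) * z.2 ^ j * (k.choose j : ℝ) := by
    intro z
    rw [add_comm, add_pow]
    exact Finset.sum_congr rfl fun j _ => by ring
  have hi : ∀ j ∈ Finset.range (k+1),
      Integrable (fun z : ℝ × ℝ => z.1 ^ (k-j) * z.2 ^ j * (k.choose j : ℝ)) (α.prod β) :=
    fun j _ => ((hα (k-j)).mul_prod (hβ j)).mul_const _
  have hm : AEMeasurable (fun z : ℝ × ℝ => z.1 + z.2) (α.prod β) := by fun_prop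
  have hf : ∀ ρ : Measure ℝ, AEStronglyMeasurable (fun x : ℝ => x ^ k) ρ := fun ρ => by fun_prop
  unfold Measure.conv
  constructor
  · rw [integrable_map_measure (hf _) hm]
    refine (integrable_finset_sum _ hi).congr (Eventually.of_forall fun z => ?_)
    simp [e]
  · rw [integral_map hm (hf _)]
    simp only [e]
    rw [integral_finset_sum _ hi]
    refine Finset.sum_congr rfl fun j _ => ?_
    rw [integral_mul_const, integral_prod_mul (fun x : ℝ => x ^ (k-j)) (fun x : ℝ => x ^ j)]

lemma cl_convPow (μ : Measure ℝ) [IsProbabilityMeasure μ]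
    (hμ : ∀ k : ℕ, Integrable (fun x : ℝ => x ^ k) μ) (N : ℕ) :
    IsProbabilityMeasure (convPow μ N) ∧
      ∀ k : ℕ, Integrable (fun x : ℝ => x ^ k) (convPow μ N) := by
  induction N with
  | zero =>
    refine ⟨by unfold convPow; infer_instance, fun k => ?_⟩
    unfold convPow
    exact integrable_dirac (by simp)
  | succ N ih =>
    obtain ⟨h1, h2⟩ := ih
    exact ⟨by unfold convPow; infer_instance, fun k => (cl_conv_pow _ _ h2 hμ k).1⟩

lemma cl_rec (μ : Measure ℝ) [IsProbabilityMeasure μ]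
    (hμ : ∀ k : ℕ, Integrable (fun x : ℝ => x ^ k) μ) (hmean : ∫ x, x ∂μ = 0) :
    ClRec (fun k => ∫ x, x ^ k ∂μ) (fun k N => ∫ x, x ^ k ∂(convPow μ N)) := by
  refine ⟨fun k => ?_, fun k N => ?_, by simp, by simpa using hmean⟩
  · simp [convPow]
  · have := (cl_convPow μ hμ N).1
    exact (cl_conv_pow _ _ (cl_convPow μ hμ N).2 hμ k).2

lemma cl_gauss (v : NNReal) (N : ℕ) :
    convPow (gaussianReal 0 v) N = gaussianReal 0 (N * v) := by
  induction N with
  | zero => simp [convPow]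
  | succ N ih =>
    rw [convPow, ih, gaussianReal_conv_gaussianReal]
    congr 1
    · simp
    · push_cast; ring

lemma cl_gauss_int (v : NNReal) (k : ℕ) : Integrable (fun x : ℝ => x ^ k) (gaussianReal 0 v) := by
  have h := (memLp_id_gaussianReal (μ := 0) (v := v) (k : NNReal)).integrable_norm_pow'
  refine (integrable_norm_iff (by fun_prop)).1 ?_
  simpa using h

lemma cl_gauss_scale (v : NNReal) (N : ℕ) (hN : 1 ≤ N) :
    Measure.map (fun x : ℝ => x / Real.sqrt N) (convPow (gaussianReal 0 v) N)
      = gaussianReal 0 v := by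
  rw [cl_gauss, gaussianReal_map_div_const]
  congr 1
  · simp
  · ext
    have : (N:ℝ) ≠ 0 := by positivity
    simp [Real.sq_sqrt]
    field_simp

lemma cl_moment_scale (ρ : Measure ℝ) (N k : ℕ) :
    ∫ x, x ^ k ∂(Measure.map (fun x : ℝ => x / Real.sqrt N) ρ)
      = (∫ x, x ^ k ∂ρ) / Real.sqrt N ^ k := by
  rw [integral_map (by fun_prop) (by fun_prop)]
  simp only [div_pow]
  rw [integral_div]




/-- Corollary to Theorem 2 (finite sums of moments, commutative content): for a
probability measure `μ` on `ℝ` with zero mean, all moments finite, and variance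
`ν`, and any real polynomial `p`, the integral of `p` against the rescaled
`N`-fold convolution `μ_N = map (x ↦ x/√N) (μ ∗ ⋯ ∗ μ)` converges to the
integral of `p` against the Gaussian measure with mean `0` and variance `ν`. -/
theorem polynomial_moments_converge_to_gaussian (μ : Measure ℝ) [IsProbabilityMeasure μ]
    (hint : ∀ k : ℕ, Integrable (fun x : ℝ => |x| ^ k) μ)
    (hmean : ∫ x, x ∂μ = 0)
    (ν : ℝ) (hν : ν = ∫ x, x ^ 2 ∂μ)
    (μs : ℕ → Measure ℝ)
    (hμs : ∀ N : ℕ, 1 ≤ N →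
      μs N = Measure.map (fun x : ℝ => x / Real.sqrt N) (convPow μ N))
    (γ : Measure ℝ) (hγ : γ = gaussianReal 0 ν.toNNReal) :
    ∀ p : Polynomial ℝ, Tendsto (fun N : ℕ => ∫ x, p.eval x ∂(μs N)) atTop
      (nhds (∫ x, p.eval x ∂γ)) := by
  intro p
  have hμ : ∀ k : ℕ, Integrable (fun x : ℝ => x ^ k) μ := fun k =>
    (integrable_norm_iff (by fun_prop)).1 (by simpa using hint k)
  have hν0 : 0 ≤ ν := by rw [hν]; exact integral_nonneg fun x => by positivity
  set v := ν.toNNReal with hv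
  have hvar : ∫ x, x ^ 2 ∂(gaussianReal 0 v) = ν := by
    have h1 := variance_id_gaussianReal (μ := 0) (v := v)
    rw [variance_of_integral_eq_zero (by fun_prop) (by simp)] at h1
    simpa [hv, hν0] using h1
  have hR := cl_rec μ hμ hmean
  have hR' := cl_rec (gaussianReal 0 v) (cl_gauss_int v) (by simp)
  have hmom : ∀ k : ℕ, Tendsto (fun N : ℕ => ∫ x, x ^ k ∂(μs N)) atTop
      (nhds (∫ x, x ^ k ∂γ)) := by
    intro k
    have ht := (hR.tendsto hR' (by simp only [hvar, hν]) k).add_const (∫ x, x ^ k ∂γ)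
    rw [zero_add] at ht
    refine ht.congr' ?_
    filter_upwards [eventually_ge_atTop 1] with N hN
    rw [hμs N hN, cl_moment_scale, sub_div, ← cl_moment_scale (convPow (gaussianReal 0 v) N),
      cl_gauss_scale v N hN, hγ]
    ring
  have hexp : ∀ ρ : Measure ℝ, (∀ k : ℕ, Integrable (fun x : ℝ => x ^ k) ρ) →
      ∫ x, p.eval x ∂ρ = ∑ i ∈ Finset.range (p.natDegree + 1), p.coeff i * ∫ x, x ^ i ∂ρ := by
    intro ρ hρ
    simp only [Polynomial.eval_eq_sum_range]
    rw [integral_finset_sum _ fun i _ => (hρ i).const_mul _]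
    simp only [integral_const_mul]
  rw [hexp γ (by rw [hγ]; exact cl_gauss_int v)]
  refine (tendsto_finset_sum _ fun i _ => (hmom i).const_mul (p.coeff i)).congr' ?_
  filter_upwards [eventually_ge_atTop 1] with N hN
  rw [hexp (μs N)]
  intro k
  rw [hμs N hN, integrable_map_measure (by fun_prop) (by fun_prop)]
  simpa [Function.comp_def, div_pow] using ((cl_convPow μ hμ N).2 k).div_const (Real.sqrt N ^ k)
end
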